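/- The five vectors v_j ⊗ w_j, j = 0,…,4, are pairwise orthogonal unit product vectors in ℂ³ ⊗ ℂ⁴. This set is extendible (there exists a nonzero product vector in ℂ³ ⊗ ℂ⁴ orthogonal to all five), but it is not completable: no orthonormal basis of ℂ³ ⊗ ℂ⁴ consisting entirely of product vectors contains all five vectors v_j ⊗ w_j. -/

import Mathlib

/-!
STATEMENT 14. The five vectors v_j ⊗ w_j are pairwise orthogonal unit product vectors in
ℂ³ ⊗ ℂ⁴; the set is extendible (some nonzero product vector is orthogonal to all five)
but not completable (no orthonormal product basis of ℂ³ ⊗ ℂ⁴ contains all five).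
-/

open ComplexConjugate

noncomputable section

/-- The standard hermitian inner product on `ι → ℂ` (antilinear in the first slot). -/
def ip {ι : Type*} [Fintype ι] (x y : ι → ℂ) : ℂ := ∑ i, conj (x i) * y i

/-- Bipartite product (Kronecker) vector `a ⊗ b`. -/
def pv2 {ι κ : Type*} (a : ι → ℂ) (b : κ → ℂ) : ι × κ → ℂ := fun p => a p.1 * b p.2

/-- Height of the pentagonal pyramid: `h = (1/2)√(1+√5)`. -/
def pyrH : ℝ := (1 / 2) * Real.sqrt (1 + Real.sqrt 5)

/-- Normalization `N = 2/√(5+√5)`. -/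
def pyrN : ℝ := 2 / Real.sqrt (5 + Real.sqrt 5)

/-- The Pyramid vectors `v_j = N (cos(2πj/5), sin(2πj/5), h) ∈ ℝ³ ⊂ ℂ³`. -/
def pyrV (j : Fin 5) : Fin 3 → ℂ :=
  ![((pyrN * Real.cos (2 * Real.pi * (j : ℕ) / 5) : ℝ) : ℂ),
    ((pyrN * Real.sin (2 * Real.pi * (j : ℕ) / 5) : ℝ) : ℂ),
    ((pyrN * pyrH : ℝ) : ℂ)]

/-- Normalization `N' = √(2/√5)`. -/
def wN : ℝ := Real.sqrt (2 / Real.sqrt 5)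

/-- The vectors `w_j = N'(√cos(π/5) cos(2jπ/5), √cos(π/5) sin(2jπ/5),
√cos(2π/5) cos(4jπ/5), √cos(2π/5) sin(4jπ/5)) ∈ ℝ⁴ ⊂ ℂ⁴`. -/
def wV (j : Fin 5) : Fin 4 → ℂ :=
  ![((wN * (Real.sqrt (Real.cos (Real.pi / 5)) * Real.cos (2 * (j : ℕ) * Real.pi / 5)) : ℝ) : ℂ),
    ((wN * (Real.sqrt (Real.cos (Real.pi / 5)) * Real.sin (2 * (j : ℕ) * Real.pi / 5)) : ℝ) : ℂ),
    ((wN * (Real.sqrt (Real.cos (2 * Real.pi / 5)) * Real.cos (4 * (j : ℕ) * Real.pi / 5)) : ℝ) : ℂ),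
    ((wN * (Real.sqrt (Real.cos (2 * Real.pi / 5)) * Real.sin (4 * (j : ℕ) * Real.pi / 5)) : ℝ) : ℂ)]

/-- The five product states `v_j ⊗ w_j` in ℂ³ ⊗ ℂ⁴. -/
def vw (j : Fin 5) : Fin 3 × Fin 4 → ℂ := pv2 (pyrV j) (wV j)

/-- Values of `cos (2πn/5)` in terms of the golden ratio `f`. -/
def pentCos (f : ℝ) : Fin 5 → ℝ := ![1, (f - 1) / 2, -f / 2, -f / 2, (f - 1) / 2]

/-- Values of `sin (2πn/5)` in terms of the golden ratio `f` and `s = sin (2π/5)`. -/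
def pentSin (f s : ℝ) : Fin 5 → ℝ := ![0, s, (f - 1) * s, -((f - 1) * s), -s]

lemma pentCos_two_mul (f : ℝ) (j : Fin 5) :
    pentCos f (2 * j) = ![1, -f / 2, (f - 1) / 2, (f - 1) / 2, -f / 2] j := by
  fin_cases j <;> rfl

lemma pentSin_two_mul (f s : ℝ) (j : Fin 5) :
    pentSin f s (2 * j) = ![0, (f - 1) * s, -s, s, -((f - 1) * s)] j := by
  fin_cases j <;> rfl

lemma cos_pi_div_five_eq_goldenRatio : Real.cos (Real.pi / 5) = Real.goldenRatio / 2 := by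
  rw [Real.cos_pi_div_five, Real.goldenRatio]; ring

lemma cos_two_pi_div_five_eq_goldenRatio :
    Real.cos (2 * Real.pi / 5) = (Real.goldenRatio - 1) / 2 := by
  rw [mul_div_assoc, Real.cos_two_mul, cos_pi_div_five_eq_goldenRatio]
  linear_combination Real.goldenRatio_sq / 2

lemma sin_two_pi_div_five_sq :
    Real.sin (2 * Real.pi / 5) ^ 2 = (2 + Real.goldenRatio) / 4 := by
  rw [Real.sin_sq, cos_two_pi_div_five_eq_goldenRatio]
  linear_combination -Real.goldenRatio_sq / 4

lemma cos_sin_four_pi_div_five :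
    Real.cos (4 * Real.pi / 5) = -Real.goldenRatio / 2 ∧
    Real.sin (4 * Real.pi / 5) = (Real.goldenRatio - 1) * Real.sin (2 * Real.pi / 5) := by
  have h : 4 * Real.pi / 5 = 2 * (2 * Real.pi / 5) := by ring
  rw [h, Real.cos_two_mul, Real.sin_two_mul, cos_two_pi_div_five_eq_goldenRatio]
  constructor
  · linear_combination Real.goldenRatio_sq / 2
  · ring

lemma cos_sin_pent (j : Fin 5) :
    Real.cos (2 * Real.pi * (j : ℕ) / 5) = pentCos Real.goldenRatio j ∧
    Real.sin (2 * Real.pi * (j : ℕ) / 5) =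
      pentSin Real.goldenRatio (Real.sin (2 * Real.pi / 5)) j := by
  obtain ⟨h2, h2'⟩ := cos_sin_four_pi_div_five
  have h1 := cos_two_pi_div_five_eq_goldenRatio
  have e2 : 2 * Real.pi * 2 / 5 = 4 * Real.pi / 5 := by ring
  have e3 : 2 * Real.pi * 3 / 5 = 2 * Real.pi - 4 * Real.pi / 5 := by ring
  have e4 : 2 * Real.pi * 4 / 5 = 2 * Real.pi - 2 * Real.pi / 5 := by ring
  fin_cases j <;>
    simp [pentCos, pentSin, h1, h2, h2', e2, e3, e4, Real.cos_two_pi_sub, Real.sin_two_pi_sub]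

lemma cos_sin_pent_natCast (n : ℕ) :
    Real.cos (2 * Real.pi * n / 5) = pentCos Real.goldenRatio (Fin.ofNat 5 n) ∧
    Real.sin (2 * Real.pi * n / 5) =
      pentSin Real.goldenRatio (Real.sin (2 * Real.pi / 5)) (Fin.ofNat 5 n) := by
  have h : 2 * Real.pi * n / 5 =
      2 * Real.pi * ((Fin.ofNat 5 n : Fin 5) : ℕ) / 5 + (n / 5 : ℕ) * (2 * Real.pi) := by
    have : (n : ℝ) = (n % 5 : ℕ) + 5 * (n / 5 : ℕ) := by exact_mod_cast (Nat.mod_add_div n 5).symm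
    simp only [Fin.val_ofNat]
    rw [this]; ring
  rw [h, Real.cos_add_nat_mul_two_pi, Real.sin_add_nat_mul_two_pi]
  exact cos_sin_pent _
lemma sqrt_five_eq_goldenRatio : √5 = 2 * Real.goldenRatio - 1 := by
  rw [Real.goldenRatio]; ring

lemma pyrN_sq : pyrN ^ 2 = 2 / 5 * (3 - Real.goldenRatio) := by
  rw [pyrN, div_pow, Real.sq_sqrt (by positivity), sqrt_five_eq_goldenRatio,
    div_eq_iff (by linarith [Real.one_lt_goldenRatio])]
  linear_combination (4 / 5) * Real.goldenRatio_sq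

lemma pyrN_mul_pyrH_sq : (pyrN * pyrH) ^ 2 = (2 * Real.goldenRatio - 1) / 5 := by
  rw [mul_pow, pyrN_sq, pyrH, mul_pow, Real.sq_sqrt (by positivity), sqrt_five_eq_goldenRatio]
  linear_combination -(1 / 5) * Real.goldenRatio_sq

lemma wN_sq : wN ^ 2 = 2 / 5 * (2 * Real.goldenRatio - 1) := by
  rw [wN, Real.sq_sqrt (by positivity), ← sqrt_five_eq_goldenRatio, div_eq_iff (by positivity)]
  linear_combination -(2 / 5) * Real.sq_sqrt (show (0 : ℝ) ≤ 5 by norm_num)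

lemma wN_mul_sqrt_cos_pi_div_five_sq :
    (wN * √(Real.cos (Real.pi / 5))) ^ 2 = (2 + Real.goldenRatio) / 5 := by
  rw [mul_pow, wN_sq, cos_pi_div_five_eq_goldenRatio,
    Real.sq_sqrt (by linarith [Real.one_lt_goldenRatio])]
  linear_combination (2 / 5) * Real.goldenRatio_sq

lemma wN_mul_sqrt_cos_two_pi_div_five_sq :
    (wN * √(Real.cos (2 * Real.pi / 5))) ^ 2 = (3 - Real.goldenRatio) / 5 := by
  rw [mul_pow, wN_sq, cos_two_pi_div_five_eq_goldenRatio,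
    Real.sq_sqrt (by linarith [Real.one_lt_goldenRatio])]
  linear_combination (2 / 5) * Real.goldenRatio_sq

lemma ip_pv2 {ι κ : Type*} [Fintype ι] [Fintype κ] (a c : ι → ℂ) (b d : κ → ℂ) :
    ip (pv2 a b) (pv2 c d) = ip a c * ip b d := by
  simp only [ip, pv2, Fintype.sum_prod_type, Finset.sum_mul_sum, map_mul]
  exact Finset.sum_congr rfl fun _ _ => Finset.sum_congr rfl fun _ _ => by ring

lemma ip_pyrV (j : Fin 5) (x : Fin 3 → ℂ) :
    ip (pyrV j) x = (pyrN : ℂ) * pentCos Real.goldenRatio j * x 0 +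
      (pyrN : ℂ) * pentSin Real.goldenRatio (Real.sin (2 * Real.pi / 5)) j * x 1 +
      ((pyrN * pyrH : ℝ) : ℂ) * x 2 := by
  simp [ip, pyrV, Fin.sum_univ_three, cos_sin_pent, -Complex.ofReal_cos, -Complex.ofReal_sin]

lemma ip_wV (j : Fin 5) (y : Fin 4 → ℂ) :
    ip (wV j) y =
      ((wN * √(Real.cos (Real.pi / 5)) : ℝ) : ℂ) *
        (pentCos Real.goldenRatio j * y 0 +
          pentSin Real.goldenRatio (Real.sin (2 * Real.pi / 5)) j * y 1) +
      ((wN * √(Real.cos (2 * Real.pi / 5)) : ℝ) : ℂ) *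
        (pentCos Real.goldenRatio (2 * j) * y 2 +
          pentSin Real.goldenRatio (Real.sin (2 * Real.pi / 5)) (2 * j) * y 3) := by
  have h1 : 2 * (j : ℕ) * Real.pi / 5 = 2 * Real.pi * (j : ℕ) / 5 := by ring
  have h2 : 4 * (j : ℕ) * Real.pi / 5 = 2 * Real.pi * (2 * j : ℕ) / 5 := by push_cast; ring
  have h3 : Fin.ofNat 5 (2 * (j : ℕ)) = 2 * j := by ext; simp [Fin.val_mul]
  simp only [ip, wV, Fin.sum_univ_four, h1, h2, cos_sin_pent_natCast, h3]
  simp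
  ring

lemma ip_pyrV_pyrV (j k : Fin 5) :
    ip (pyrV j) (pyrV k) =
      ((![1, Real.goldenRatio - 1, 0, 0, Real.goldenRatio - 1] (k - j) : ℝ) : ℂ) := by
  rw [ip_pyrV]
  have h := Real.goldenRatio_sq
  have hN := pyrN_sq
  have hH := pyrN_mul_pyrH_sq
  have hs := sin_two_pi_div_five_sq
  simp only [pyrV, cos_sin_pent, Matrix.cons_val]
  norm_cast
  generalize pyrN * pyrH = H at *
  generalize pyrN = N at *
  generalize Real.goldenRatio = f at *
  generalize Real.sin (2 * Real.pi / 5) = s at *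
  fin_cases j <;> fin_cases k <;> simp [pentCos, pentSin] <;> grind

lemma ip_wV_wV (j k : Fin 5) :
    ip (wV j) (wV k) = ((![1, 0, -2⁻¹, -2⁻¹, 0] (k - j) : ℝ) : ℂ) := by
  rw [ip_wV]
  have h := Real.goldenRatio_sq
  have hP := wN_mul_sqrt_cos_pi_div_five_sq
  have hQ := wN_mul_sqrt_cos_two_pi_div_five_sq
  have hs := sin_two_pi_div_five_sq
  have h1 (j : Fin 5) : 2 * (j : ℕ) * Real.pi / 5 = 2 * Real.pi * (j : ℕ) / 5 := by ring
  have h2 (j : Fin 5) : 4 * (j : ℕ) * Real.pi / 5 = 2 * Real.pi * (2 * j : ℕ) / 5 := by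
    push_cast; ring
  have h3 (j : Fin 5) : Fin.ofNat 5 (2 * (j : ℕ)) = 2 * j := by ext; simp [Fin.val_mul]
  have h4 (j : Fin 5) : Fin.ofNat 5 (j : ℕ) = j := by ext; simp
  simp only [wV, h1, h2, cos_sin_pent_natCast, h3, h4, Matrix.cons_val, ← mul_assoc,
    pentCos_two_mul, pentSin_two_mul]
  simp only [← Complex.ofReal_mul, ← Complex.ofReal_add, Complex.ofReal_inj]
  generalize wN * √(Real.cos (Real.pi / 5)) = P at *
  generalize wN * √(Real.cos (2 * Real.pi / 5)) = Q at *
  generalize Real.goldenRatio = f at *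
  generalize Real.sin (2 * Real.pi / 5) = s at *
  clear h1 h2 h3 h4
  simp only [pentCos, pentSin]
  fin_cases j <;> fin_cases k <;> simp <;> grind

/-- Consecutive coefficients with respect to the Pyramid vectors satisfy a linear recurrence. -/
lemma ip_pyrV_add_three (x : Fin 3 → ℂ) (j : Fin 5) :
    ip (pyrV (j + 3)) x = ((Real.goldenRatio : ℝ) : ℂ) *
      (ip (pyrV (j + 2)) x - ip (pyrV (j + 1)) x) + ip (pyrV j) x := by
  have h : ((Real.goldenRatio : ℝ) : ℂ) ^ 2 = Real.goldenRatio + 1 := by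
    exact_mod_cast Real.goldenRatio_sq
  simp only [ip_pyrV]
  generalize Real.goldenRatio = f at *
  generalize Real.sin (2 * Real.pi / 5) = s at *
  fin_cases j <;> simp [pentCos, pentSin] <;> grind

lemma sum_ip_wV (y : Fin 4 → ℂ) : ∑ j, ip (wV j) y = 0 := by
  simp only [ip_wV, pentCos_two_mul, pentSin_two_mul, Fin.sum_univ_five]
  generalize wN * √(Real.cos (Real.pi / 5)) = P at *
  generalize wN * √(Real.cos (2 * Real.pi / 5)) = Q at *
  generalize Real.goldenRatio = f at *
  generalize Real.sin (2 * Real.pi / 5) = s at *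
  simp [pentCos, pentSin]
  ring

lemma ip_eq_of_pyrV (x x' : Fin 3 → ℂ) :
    5 * (2 * ((Real.goldenRatio : ℝ) : ℂ) - 1) * ip x x' =
      5 * ((Real.goldenRatio : ℝ) : ℂ) * ∑ j, conj (ip (pyrV j) x) * ip (pyrV j) x' -
      (((Real.goldenRatio : ℝ) : ℂ) - 1) *
        (conj (∑ j, ip (pyrV j) x) * ∑ j, ip (pyrV j) x') := by
  have h : ((Real.goldenRatio : ℝ) : ℂ) ^ 2 = Real.goldenRatio + 1 := by
    exact_mod_cast Real.goldenRatio_sq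
  have hN : (pyrN : ℂ) ^ 2 = 2 / 5 * (3 - (Real.goldenRatio : ℝ)) := by
    rw [← Complex.ofReal_pow, pyrN_sq]; push_cast; rfl
  have hH : ((pyrN * pyrH : ℝ) : ℂ) ^ 2 = (2 * (Real.goldenRatio : ℝ) - 1) / 5 := by
    exact_mod_cast pyrN_mul_pyrH_sq
  have hs : ((Real.sin (2 * Real.pi / 5) : ℝ) : ℂ) ^ 2 = (2 + (Real.goldenRatio : ℝ)) / 4 := by
    exact_mod_cast sin_two_pi_div_five_sq
  simp only [ip_pyrV, Fin.sum_univ_five, map_add, map_mul, Complex.conj_ofReal]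
  generalize pyrN * pyrH = H at *
  generalize Real.goldenRatio = f at *
  generalize Real.sin (2 * Real.pi / 5) = s at *
  simp [ip, Fin.sum_univ_three, pentCos, pentSin]
  generalize (H : ℂ) = H at *
  generalize (pyrN : ℂ) = N at *
  generalize (f : ℂ) = f at *
  generalize (s : ℂ) = s at *
  generalize conj (x 0) = a, conj (x 1) = b, conj (x 2) = c
  generalize x' 0 = a', x' 1 = b', x' 2 = c'
  grind

lemma ip_eq_of_wV (y y' : Fin 4 → ℂ) :
    5 * ip y y' = 2 * ∑ j : Fin 5, conj (ip (wV j) y - ip (wV (j + 1)) y) *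
      (ip (wV j) y' - ip (wV (j + 1)) y') := by
  have h : ((Real.goldenRatio : ℝ) : ℂ) ^ 2 = Real.goldenRatio + 1 := by
    exact_mod_cast Real.goldenRatio_sq
  have hP : ((wN * √(Real.cos (Real.pi / 5)) : ℝ) : ℂ) ^ 2 = (2 + (Real.goldenRatio : ℝ)) / 5 := by
    exact_mod_cast wN_mul_sqrt_cos_pi_div_five_sq
  have hQ : ((wN * √(Real.cos (2 * Real.pi / 5)) : ℝ) : ℂ) ^ 2 =
      (3 - (Real.goldenRatio : ℝ)) / 5 := by
    exact_mod_cast wN_mul_sqrt_cos_two_pi_div_five_sq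
  have hs : ((Real.sin (2 * Real.pi / 5) : ℝ) : ℂ) ^ 2 = (2 + (Real.goldenRatio : ℝ)) / 4 := by
    exact_mod_cast sin_two_pi_div_five_sq
  simp only [ip_wV, pentCos_two_mul, pentSin_two_mul, Fin.sum_univ_five,
    map_add, map_sub, map_mul, Complex.conj_ofReal]
  generalize wN * √(Real.cos (Real.pi / 5)) = P at *
  generalize wN * √(Real.cos (2 * Real.pi / 5)) = Q at *
  generalize Real.goldenRatio = f at *
  generalize Real.sin (2 * Real.pi / 5) = s at *
  simp [ip, Fin.sum_univ_four, pentCos, pentSin]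
  generalize (P : ℂ) = P at *
  generalize (Q : ℂ) = Q at *
  generalize (f : ℂ) = f at *
  generalize (s : ℂ) = s at *
  generalize conj (y 0) = a, conj (y 1) = b, conj (y 2) = c, conj (y 3) = d
  generalize y' 0 = a', y' 1 = b', y' 2 = c', y' 3 = d'
  grind

open scoped ComplexOrder in
lemma eq_zero_of_ip_self {ι : Type*} [Fintype ι] {x : ι → ℂ} (h : ip x x = 0) : x = 0 :=
  dotProduct_self_star_eq_zero.mp ((dotProduct_comm _ _).trans h)

lemma ip_add_right {ι : Type*} [Fintype ι] (x y z : ι → ℂ) : ip x (y + z) = ip x y + ip x z :=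
  dotProduct_add (star x) y z

lemma ip_smul_right {ι : Type*} [Fintype ι] (x : ι → ℂ) (c : ℂ) (y : ι → ℂ) :
    ip x (c • y) = c * ip x y :=
  dotProduct_smul c (star x) y

lemma two_goldenRatio_sub_one_ne_zero : 2 * ((Real.goldenRatio : ℝ) : ℂ) - 1 ≠ 0 := by
  have h : 2 * Real.goldenRatio - 1 ≠ 0 := by linarith [Real.one_lt_goldenRatio]
  exact_mod_cast h

lemma eq_zero_of_ip_pyrV {x : Fin 3 → ℂ} (h : ∀ j, ip (pyrV j) x = 0) : x = 0 := by
  have := ip_eq_of_pyrV x x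
  simp only [h, mul_zero, Finset.sum_const_zero, sub_zero] at this
  exact eq_zero_of_ip_self ((mul_eq_zero.mp this).resolve_left
    (mul_ne_zero (by norm_num) two_goldenRatio_sub_one_ne_zero))

lemma eq_zero_of_ip_wV {y : Fin 4 → ℂ} (h : ∀ j, ip (wV j) y = 0) : y = 0 := by
  have := ip_eq_of_wV y y
  simp only [h, mul_zero, Finset.sum_const_zero, sub_zero] at this
  exact eq_zero_of_ip_self ((mul_eq_zero.mp this).resolve_left (by norm_num))

lemma forall_fin_five {P : Fin 5 → Prop} (j : Fin 5) (h : ∀ i, P (j + i)) (i : Fin 5) : P i := by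
  simpa using h (i - j)

lemma goldenRatio_ofReal_ne_zero : ((Real.goldenRatio : ℝ) : ℂ) ≠ 0 :=
  Complex.ofReal_ne_zero.mpr Real.goldenRatio_ne_zero

/-- Three vanishing coefficients force a vector of `ℂ³` to vanish. -/
lemma eq_zero_of_ip_pyrV_consecutive {x : Fin 3 → ℂ} (j : Fin 5) (h0 : ip (pyrV j) x = 0)
    (h1 : ip (pyrV (j + 1)) x = 0) (h2 : ip (pyrV (j + 2)) x = 0) : x = 0 := by
  have h3 : ip (pyrV (j + 3)) x = 0 := by rw [ip_pyrV_add_three, h0, h1, h2]; ring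
  have h4 := ip_pyrV_add_three x (j + 1)
  rw [add_assoc, add_assoc, add_assoc, show (1 + 3 : Fin 5) = 4 from rfl,
    show (1 + 2 : Fin 5) = 3 from rfl, show (1 + 1 : Fin 5) = 2 from rfl, h1, h2, h3] at h4
  refine eq_zero_of_ip_pyrV (forall_fin_five j fun i => ?_)
  fin_cases i
  · simpa using h0
  · exact h1
  · exact h2
  · exact h3
  · simpa using h4

lemma eq_zero_of_ip_pyrV_skip {x : Fin 3 → ℂ} (j : Fin 5) (h0 : ip (pyrV j) x = 0)
    (h1 : ip (pyrV (j + 1)) x = 0) (h3 : ip (pyrV (j + 3)) x = 0) : x = 0 := by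
  have h := ip_pyrV_add_three x j
  rw [h0, h1, h3, add_zero, sub_zero] at h
  exact eq_zero_of_ip_pyrV_consecutive j h0 h1
    ((mul_eq_zero.mp h.symm).resolve_left goldenRatio_ofReal_ne_zero)

lemma exists_pattern_of_three {S : Finset (Fin 5)} (h : 2 < S.card) :
    ∃ j ∈ S, j + 1 ∈ S ∧ (j + 2 ∈ S ∨ j + 3 ∈ S) := by
  revert S; decide

lemma exists_pattern_of_two {S : Finset (Fin 5)} (h : S.card = 2) :
    ∃ j, S = {j, j + 1} ∨ S = {j, j + 2} := by
  revert S; decide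

lemma card_ip_pyrV_eq_zero_le {x : Fin 3 → ℂ} (hx : x ≠ 0) {S : Finset (Fin 5)}
    (hS : ∀ j ∈ S, ip (pyrV j) x = 0) : S.card ≤ 2 := by
  by_contra! h
  obtain ⟨j, h0, h1, h2 | h3⟩ := exists_pattern_of_three h
  · exact hx (eq_zero_of_ip_pyrV_consecutive j (hS _ h0) (hS _ h1) (hS _ h2))
  · exact hx (eq_zero_of_ip_pyrV_skip j (hS _ h0) (hS _ h1) (hS _ h3))

lemma card_ip_wV_eq_zero_le {y : Fin 4 → ℂ} (hy : y ≠ 0) {T : Finset (Fin 5)}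
    (hT : ∀ j ∈ T, ip (wV j) y = 0) : T.card ≤ 3 := by
  by_contra! h
  have hc : Tᶜ.card ≤ 1 := by rw [Finset.card_compl, Fintype.card_fin]; omega
  obtain ⟨j, hj⟩ := Finset.card_le_one_iff_subset_singleton.mp hc
  have hne : ∀ i, i ≠ j → ip (wV i) y = 0 := fun i hi =>
    hT i (by_contra fun hi' => hi (Finset.mem_singleton.mp (hj (Finset.mem_compl.mpr hi'))))
  have hsum := sum_ip_wV y
  rw [Finset.sum_eq_single j (fun i _ => hne i) (by simp)] at hsum
  exact hy (eq_zero_of_ip_wV fun i => if hi : i = j then hi ▸ hsum else hne i hi)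

/-- Coefficients, up to scale, of a vector orthogonal to two adjacent Pyramid vectors. -/
def adjV : Fin 5 → ℝ := ![0, 0, 1, Real.goldenRatio, 1]

/-- Coefficients, up to scale, of a vector orthogonal to all `w_i` but two adjacent ones. -/
def adjW : Fin 5 → ℝ := ![1, -1, 0, 0, 0]

/-- Coefficients, up to scale, of a vector orthogonal to two non-adjacent Pyramid vectors. -/
def skipV : Fin 5 → ℝ := ![0, 1, 0, -Real.goldenRatio, -Real.goldenRatio]

/-- Coefficients, up to scale, of a vector orthogonal to all `w_i` but two non-adjacent ones. -/
def skipW : Fin 5 → ℝ := ![1, 0, -1, 0, 0]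

/-- The coefficients of `x` and `y` are nonzero multiples of `p` and `q` rotated by `j`. -/
def HasProfile (p q : Fin 5 → ℝ) (j : Fin 5) (x : Fin 3 → ℂ) (y : Fin 4 → ℂ) : Prop :=
  (∃ c : ℂ, c ≠ 0 ∧ ∀ i, ip (pyrV i) x = c * (p (i - j) : ℝ)) ∧
  ∃ d : ℂ, d ≠ 0 ∧ ∀ i, ip (wV i) y = d * (q (i - j) : ℝ)

/-- A product vector orthogonal to all `v_j ⊗ w_j` has one of two shapes up to rotation. -/
lemma exists_hasProfile {x : Fin 3 → ℂ} {y : Fin 4 → ℂ} (hx : x ≠ 0) (hy : y ≠ 0)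
    (h : ∀ j, ip (pyrV j) x * ip (wV j) y = 0) :
    ∃ j, HasProfile adjV adjW j x y ∨ HasProfile skipV skipW j x y := by
  classical
  set S := Finset.univ.filter fun j => ip (pyrV j) x = 0
  set T := Finset.univ.filter fun j => ip (wV j) y = 0
  have hS := card_ip_pyrV_eq_zero_le hx (S := S) (by simp [S])
  have hT := card_ip_wV_eq_zero_le hy (T := T) (by simp [T])
  have hU : S ∪ T = Finset.univ := by
    ext j; simpa [S, T] using h j
  have hcard := Finset.card_union_le S T
  rw [hU, Finset.card_univ, Fintype.card_fin] at hcard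
  have hα (i) (hi : i ∈ S) : ip (pyrV i) x = 0 := (Finset.mem_filter.mp hi).2
  have hβ (i) (hi : i ∉ S) : ip (wV i) y = 0 := by
    have : i ∈ S ∪ T := hU ▸ Finset.mem_univ i
    exact (Finset.mem_filter.mp ((Finset.mem_union.mp this).resolve_left hi)).2
  clear_value S
  have hsum := sum_ip_wV y
  have hrec := ip_pyrV_add_three x
  have hφ : ((Real.goldenRatio : ℝ) : ℂ) ^ 2 = Real.goldenRatio + 1 := by
    exact_mod_cast Real.goldenRatio_sq
  have hx0 {c : ℂ} {p : Fin 5 → ℝ} {j : Fin 5} (hp : ∀ i, ip (pyrV i) x = c * (p (i - j) : ℝ)) :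
      c ≠ 0 := by
    rintro rfl
    exact hx (eq_zero_of_ip_pyrV fun i => by rw [hp, zero_mul])
  have hy0 {d : ℂ} {q : Fin 5 → ℝ} {j : Fin 5} (hq : ∀ i, ip (wV i) y = d * (q (i - j) : ℝ)) :
      d ≠ 0 := by
    rintro rfl
    exact hy (eq_zero_of_ip_wV fun i => by rw [hq, zero_mul])
  obtain ⟨j, rfl | rfl⟩ := exists_pattern_of_two (show S.card = 2 by omega)
  · refine ⟨j, .inl ?_⟩
    have hα' : ∀ i, ip (pyrV i) x = ip (pyrV (j + 2)) x * (adjV (i - j) : ℝ) := by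
      refine forall_fin_five j fun i => ?_
      have h0 := hα j (by simp)
      have h1 := hα (j + 1) (by simp)
      have h3 := hrec j
      have h4 := hrec (j + 2)
      rw [h0, h1] at h3
      rw [show j + 2 + 3 = j by lia, show j + 2 + 1 = j + 3 by lia,
        show j + 2 + 2 = j + 4 by lia, h0] at h4
      have h4' : ip (pyrV (j + 4)) x = ip (pyrV (j + 2)) x := by
        refine mul_left_cancel₀ goldenRatio_ofReal_ne_zero ?_
        linear_combination -h4 + ((Real.goldenRatio : ℝ) : ℂ) * h3 +
          ip (pyrV (j + 2)) x * hφ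
      rw [add_sub_cancel_left, adjV]
      generalize Real.goldenRatio = f at *
      fin_cases i <;> simp [h0, h1, h3, h4', mul_comm]
    have hβ' : ∀ i, ip (wV i) y = ip (wV j) y * (adjW (i - j) : ℝ) := by
      rw [← Equiv.sum_comp (Equiv.addLeft j)] at hsum
      refine forall_fin_five j fun i => ?_
      have h2 := hβ (j + 2) (by simp)
      have h3 := hβ (j + 3) (by simp)
      have h4 := hβ (j + 4) (by simp)
      simp [Fin.sum_univ_five, h2, h3, h4] at hsum
      rw [add_sub_cancel_left, adjW]
      fin_cases i <;> simp [h2, h3, h4, eq_neg_of_add_eq_zero_right hsum]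
    exact ⟨⟨_, hx0 hα', hα'⟩, _, hy0 hβ', hβ'⟩
  · refine ⟨j, .inr ?_⟩
    have hα' : ∀ i, ip (pyrV i) x = ip (pyrV (j + 1)) x * (skipV (i - j) : ℝ) := by
      refine forall_fin_five j fun i => ?_
      have h0 := hα j (by simp)
      have h2 := hα (j + 2) (by simp)
      have h3 := hrec j
      have h4 := hrec (j + 4)
      rw [h0, h2] at h3
      rw [show j + 4 + 3 = j + 2 by lia, show j + 4 + 2 = j + 1 by lia,
        show j + 4 + 1 = j by lia, h0, h2] at h4
      have h4' : ip (pyrV (j + 4)) x =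
          -(((Real.goldenRatio : ℝ) : ℂ) * ip (pyrV (j + 1)) x) := by
        linear_combination -h4
      rw [add_sub_cancel_left, skipV]
      generalize Real.goldenRatio = f at *
      fin_cases i <;> simp [h0, h2, h3, h4', mul_comm]
    have hβ' : ∀ i, ip (wV i) y = ip (wV j) y * (skipW (i - j) : ℝ) := by
      rw [← Equiv.sum_comp (Equiv.addLeft j)] at hsum
      refine forall_fin_five j fun i => ?_
      have h1 := hβ (j + 1) (by simp)
      have h3 := hβ (j + 3) (by simp)
      have h4 := hβ (j + 4) (by simp)
      simp [Fin.sum_univ_five, h1, h3, h4] at hsum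
      rw [add_sub_cancel_left, skipW]
      fin_cases i <;> simp [h1, h3, h4, eq_neg_of_add_eq_zero_right hsum]
    exact ⟨⟨_, hx0 hα', hα'⟩, _, hy0 hβ', hβ'⟩

lemma ip_ne_zero_of_pyrV {p p' : Fin 5 → ℝ} {x x' : Fin 3 → ℂ} {c c' : ℂ} (hc : c ≠ 0)
    (hc' : c' ≠ 0) (hx : ∀ i, ip (pyrV i) x = c * (p i : ℝ))
    (hx' : ∀ i, ip (pyrV i) x' = c' * (p' i : ℝ))
    (hp : 5 * Real.goldenRatio * ∑ i, p i * p' i -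
      (Real.goldenRatio - 1) * ((∑ i, p i) * ∑ i, p' i) ≠ 0) : ip x x' ≠ 0 := by
  intro h
  have key := ip_eq_of_pyrV x x'
  simp only [h, hx, hx', mul_zero] at key
  have : conj c * c' * ((5 * Real.goldenRatio * ∑ i, p i * p' i -
      (Real.goldenRatio - 1) * ((∑ i, p i) * ∑ i, p' i) : ℝ) : ℂ) = 0 := by
    generalize Real.goldenRatio = f at key ⊢
    push_cast
    simp only [map_mul, map_add, Complex.conj_ofReal, Fin.sum_univ_five] at key ⊢
    linear_combination -key
  exact mul_ne_zero (mul_ne_zero (star_ne_zero.mpr hc) hc') (Complex.ofReal_ne_zero.mpr hp) this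

lemma ip_ne_zero_of_wV {q q' : Fin 5 → ℝ} {y y' : Fin 4 → ℂ} {d d' : ℂ} (hd : d ≠ 0)
    (hd' : d' ≠ 0) (hy : ∀ i, ip (wV i) y = d * (q i : ℝ))
    (hy' : ∀ i, ip (wV i) y' = d' * (q' i : ℝ))
    (hq : ∑ i, (q i - q (i + 1)) * (q' i - q' (i + 1)) ≠ 0) : ip y y' ≠ 0 := by
  intro h
  have key := ip_eq_of_wV y y'
  simp only [h, hy, hy', mul_zero] at key
  have : conj d * d' * ((∑ i, (q i - q (i + 1)) * (q' i - q' (i + 1)) : ℝ) : ℂ) = 0 := by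
    push_cast
    simp only [map_mul, map_sub, Complex.conj_ofReal, Fin.sum_univ_five] at key ⊢
    linear_combination -key / 2
  exact mul_ne_zero (mul_ne_zero (star_ne_zero.mpr hd) hd') (Complex.ofReal_ne_zero.mpr hq) this

lemma HasProfile.ip_ne_zero {p q p' q' : Fin 5 → ℝ} {j k : Fin 5} {x x' : Fin 3 → ℂ}
    {y y' : Fin 4 → ℂ} (h : HasProfile p q j x y) (h' : HasProfile p' q' k x' y')
    (hp : 5 * Real.goldenRatio * ∑ i, p (i - j) * p' (i - k) -
      (Real.goldenRatio - 1) * ((∑ i, p (i - j)) * ∑ i, p' (i - k)) ≠ 0)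
    (hq : ∑ i, (q (i - j) - q (i + 1 - j)) * (q' (i - k) - q' (i + 1 - k)) ≠ 0) :
    ip (pv2 x y) (pv2 x' y') ≠ 0 := by
  obtain ⟨⟨c, hc, hx⟩, d, hd, hy⟩ := h
  obtain ⟨⟨c', hc', hx'⟩, d', hd', hy'⟩ := h'
  rw [ip_pv2]
  exact mul_ne_zero (ip_ne_zero_of_pyrV hc hc' hx hx' hp) (ip_ne_zero_of_wV hd hd' hy hy' hq)

lemma HasProfile.ip_ne_zero_of_adj {j : Fin 5} {x x' : Fin 3 → ℂ} {y y' : Fin 4 → ℂ}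
    (h : HasProfile adjV adjW j x y) (h' : HasProfile adjV adjW j x' y') :
    ip (pv2 x y) (pv2 x' y') ≠ 0 := by
  refine h.ip_ne_zero h' ?_ ?_
  · have h1 := Real.one_lt_goldenRatio
    have h2 := Real.goldenRatio_sq
    simp only [adjV]
    generalize Real.goldenRatio = f at *
    fin_cases j <;> simp [Fin.sum_univ_five] <;> nlinarith
  · fin_cases j <;> simp [adjW, Fin.sum_univ_five] <;> norm_num

lemma HasProfile.ip_ne_zero_of_skip {j k : Fin 5} {x x' : Fin 3 → ℂ} {y y' : Fin 4 → ℂ}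
    (h : HasProfile skipV skipW j x y) (h' : HasProfile skipV skipW k x' y') :
    ip (pv2 x y) (pv2 x' y') ≠ 0 := by
  refine h.ip_ne_zero h' ?_ ?_
  · have h1 := Real.one_lt_goldenRatio
    have h2 := Real.goldenRatio_sq
    simp only [skipV]
    generalize Real.goldenRatio = f at *
    fin_cases j <;> fin_cases k <;> simp [Fin.sum_univ_five] <;> grind
  · fin_cases j <;> fin_cases k <;> simp [skipW, Fin.sum_univ_five] <;> norm_num

lemma ip_vw_vw (j k : Fin 5) : ip (vw j) (vw k) = if j = k then 1 else 0 := by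
  rw [vw, vw, ip_pv2, ip_pyrV_pyrV, ip_wV_wV]
  fin_cases j <;> fin_cases k <;> simp

lemma exists_pv2_orthogonal_vw :
    ∃ (x : Fin 3 → ℂ) (y : Fin 4 → ℂ), x ≠ 0 ∧ y ≠ 0 ∧ ∀ j, ip (vw j) (pv2 x y) = 0 := by
  have hβ (j) : ip (wV j) ((3 : ℂ) • wV 0 + (-3 : ℂ) • wV 1 + (1 : ℂ) • wV 2 + (-1 : ℂ) • wV 4) =
      ((![5 / 2, -5 / 2, 0, 0, 0] j : ℝ) : ℂ) := by
    simp only [ip_add_right, ip_smul_right, ip_wV_wV]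
    fin_cases j <;> simp <;> norm_num
  generalize (3 : ℂ) • wV 0 + (-3 : ℂ) • wV 1 + (1 : ℂ) • wV 2 + (-1 : ℂ) • wV 4 = y at hβ
  refine ⟨pyrV 3, y, ?_, ?_, fun j => ?_⟩
  · intro h
    have := ip_pyrV_pyrV 3 3
    simp [h, ip] at this
  · intro h
    have := hβ 0
    norm_num [h, ip] at this
  · rw [vw, ip_pv2, hβ, ip_pyrV_pyrV]
    fin_cases j <;> simp

/-- Class of an element of a product basis: members of one class are never orthogonal. -/
def HasColor (u : Fin 3 × Fin 4 → ℂ) : Fin 5 ⊕ Fin 5 ⊕ Unit → Prop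
  | .inl j => u = vw j
  | .inr (.inl j) => ∃ x y, u = pv2 x y ∧ HasProfile adjV adjW j x y
  | .inr (.inr _) => ∃ x y j, u = pv2 x y ∧ HasProfile skipV skipW j x y

lemma HasColor.ip_ne_zero {u u' : Fin 3 × Fin 4 → ℂ} :
    ∀ {c : Fin 5 ⊕ Fin 5 ⊕ Unit}, HasColor u c → HasColor u' c → ip u u' ≠ 0
  | .inl j, h, h' => by
    rw [show u = vw j from h, show u' = vw j from h', ip_vw_vw, if_pos rfl]
    exact one_ne_zero
  | .inr (.inl _), ⟨_, _, hu, h⟩, ⟨_, _, hu', h'⟩ => hu ▸ hu' ▸ h.ip_ne_zero_of_adj h'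
  | .inr (.inr _), ⟨_, _, _, hu, h⟩, ⟨_, _, _, hu', h'⟩ => hu ▸ hu' ▸ h.ip_ne_zero_of_skip h'

lemma exists_hasColor {x : Fin 3 → ℂ} {y : Fin 4 → ℂ} (hx : x ≠ 0) (hy : y ≠ 0)
    (h : ∀ j, ip (vw j) (pv2 x y) = 0) : ∃ c, HasColor (pv2 x y) c := by
  obtain ⟨j, hj | hj⟩ := exists_hasProfile hx hy fun j => by rw [← ip_pv2]; exact h j
  · exact ⟨.inr (.inl j), x, y, rfl, hj⟩
  · exact ⟨.inr (.inr ()), x, y, j, rfl, hj⟩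

/-- **`{v_j ⊗ w_j}` is an orthonormal product family that is extendible but not
completable in ℂ³ ⊗ ℂ⁴.** -/
theorem vw_extendible_but_not_completable :
    (∀ j k : Fin 5, ip (vw j) (vw k) = if j = k then 1 else 0) ∧
    (∃ (x : Fin 3 → ℂ) (y : Fin 4 → ℂ), x ≠ 0 ∧ y ≠ 0 ∧ ∀ j, ip (vw j) (pv2 x y) = 0) ∧
    ¬ ∃ b : Fin 12 → (Fin 3 × Fin 4 → ℂ),
        (∀ s t, ip (b s) (b t) = if s = t then 1 else 0) ∧
        (∀ s, ∃ (x : Fin 3 → ℂ) (y : Fin 4 → ℂ), x ≠ 0 ∧ y ≠ 0 ∧ b s = pv2 x y) ∧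
        Submodule.span ℂ (Set.range b) = ⊤ ∧
        (∀ j, ∃ s, b s = vw j) := by

  refine ⟨ip_vw_vw, exists_pv2_orthogonal_vw, ?_⟩
  rintro ⟨b, horth, hprod, -, hvw⟩
  have hcolor (s) : ∃ c, HasColor (b s) c := by
    by_cases hs : ∃ j, b s = vw j
    · exact hs.imp' Sum.inl fun _ => id
    · obtain ⟨x, y, hx, hy, hxy⟩ := hprod s
      rw [hxy]
      refine exists_hasColor hx hy fun j => ?_
      obtain ⟨t, ht⟩ := hvw j
      rw [← ht, ← hxy, horth, if_neg]
      rintro rfl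
      exact hs ⟨j, ht⟩
  choose color hcolor using hcolor
  obtain ⟨s, t, hst, heq⟩ := Fintype.exists_ne_map_eq_of_card_lt color (by simp)
  exact (hcolor s).ip_ne_zero (heq ▸ hcolor t) (by rw [horth, if_neg hst])

end
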